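/- If X ∈ so(n+1,n+1) satisfies tr(X · i'(A)) = 0 for every A ∈ sl(n+1,ℝ) and tr(X · Y) = 0 for every Y ∈ p̃, then X = 0. (Equivalently, g^⊥ ∩ p̃₊ = {0} for the trace form, where p̃₊ = p̃^⊥; this is the key step in the proof of Proposition 3.4 on normality of Fefferman-type constructions.) -/

import Mathlib

open Matrix

noncomputable section

/-- Index type for `(2n+2)×(2n+2)` matrices split into two blocks of size `n+1`. -/
abbrev Idx (n : ℕ) : Type := Fin (n + 1) ⊕ Fin (n + 1)

/-- The split-signature Gram matrix `J = [[0,I],[I,0]]`. -/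
def Jmat (n : ℕ) : Matrix (Idx n) (Idx n) ℝ := Matrix.fromBlocks 0 1 1 0

/-- The Lie algebra `so(n+1,n+1) = {X : XᵀJ + JX = 0}`. -/
def soSplit (n : ℕ) : Set (Matrix (Idx n) (Idx n) ℝ) :=
  {X | Xᵀ * Jmat n + Jmat n * X = 0}

/-- The block embedding `i'(A) = [[A,0],[0,−Aᵀ]]`. -/
def iEmb {n : ℕ} (A : Matrix (Fin (n + 1)) (Fin (n + 1)) ℝ) : Matrix (Idx n) (Idx n) ℝ :=
  Matrix.fromBlocks A 0 0 (-Aᵀ)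

/-- The light-like vector `ṽ = e₁ + e_{2n+2}`. -/
def vtil (n : ℕ) : Idx n → ℝ :=
  Pi.single (Sum.inl 0) 1 + Pi.single (Sum.inr (Fin.last n)) 1

/-- The stabilizer subalgebra `p̃ = {X ∈ so(n+1,n+1) : Xṽ ∈ ℝṽ}`. -/
def ptil (n : ℕ) : Set (Matrix (Idx n) (Idx n) ℝ) :=
  {X ∈ soSplit n | ∃ c : ℝ, X.mulVec (vtil n) = c • vtil n}

/-- The trace of a square block matrix is the sum of the traces of its diagonal blocks. -/
theorem trace_fromBlocks_eq_add {l m α : Type*} [Fintype l] [Fintype m] [AddCommMonoid α]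
    (A : Matrix l l α) (B : Matrix l m α) (C : Matrix m l α) (D : Matrix m m α) :
    (fromBlocks A B C D).trace = A.trace + D.trace := by
  simp [trace, Fintype.sum_sum_type]

/-- `so(n+1,n+1)` in block form: diagonal blocks `A`, `-Aᵀ` and skew off-diagonal blocks. -/
theorem fromBlocks_mem_soSplit_iff {n : ℕ} {A S T D : Matrix (Fin (n + 1)) (Fin (n + 1)) ℝ} :
    fromBlocks A S T D ∈ soSplit n ↔ D = -Aᵀ ∧ Sᵀ = -S ∧ Tᵀ = -T := by
  simp only [soSplit, Jmat, Set.mem_ofPred_eq, fromBlocks_transpose, fromBlocks_multiply,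
    fromBlocks_add, mul_zero, mul_one, zero_mul, one_mul, zero_add, add_zero,
    ← fromBlocks_zero, fromBlocks_inj]
  constructor
  · rintro ⟨hT, hD, -, hS⟩
    exact ⟨eq_neg_of_add_eq_zero_right hD, eq_neg_of_add_eq_zero_left hS,
      eq_neg_of_add_eq_zero_left hT⟩
  · rintro ⟨rfl, hS, hT⟩
    simp [hS, hT]

/-- A block matrix in `so(n+1,n+1)` annihilating `ṽ` lies in `p̃`. -/
theorem fromBlocks_mem_ptil {n : ℕ} {A S T : Matrix (Fin (n + 1)) (Fin (n + 1)) ℝ}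
    (hS : Sᵀ = -S) (hT : Tᵀ = -T)
    (h₁ : A *ᵥ Pi.single 0 1 + S *ᵥ Pi.single (Fin.last n) 1 = 0)
    (h₂ : T *ᵥ Pi.single 0 1 - Aᵀ *ᵥ Pi.single (Fin.last n) 1 = 0) :
    fromBlocks A S T (-Aᵀ) ∈ ptil n := by
  refine ⟨fromBlocks_mem_soSplit_iff.2 ⟨rfl, hS, hT⟩, 0, ?_⟩
  have hv : vtil n = Sum.elim (Pi.single 0 1) (Pi.single (Fin.last n) 1) := by
    ext (i | i) <;> simp [vtil, Pi.single_apply]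
  rw [hv, fromBlocks_mulVec, zero_smul]
  ext (i | i)
  · simpa using congrFun h₁ i
  · simpa [neg_mulVec, sub_eq_add_neg] using congrFun h₂ i

/-- A matrix that is trace-orthogonal to every traceless matrix is scalar. -/
theorem eq_smul_one_of_trace_mul_eq_zero {m : Type*} [Fintype m] [DecidableEq m]
    {P : Matrix m m ℝ} (h : ∀ A : Matrix m m ℝ, A.trace = 0 → (P * A).trace = 0) (k : m) :
    P = P k k • (1 : Matrix m m ℝ) := by
  ext i j
  obtain rfl | hij := eq_or_ne i j
  · have := h (single i i 1 - single k k 1) (by simp)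
    simp only [mul_sub, trace_sub, trace_mul_single] at this
    simp at this ⊢
    linarith
  · have := h (single j i 1) (trace_single_eq_of_ne j i 1 hij.symm)
    simpa [trace_mul_single, hij] using this

/-- A real skew-symmetric matrix that is trace-orthogonal to itself vanishes. -/
theorem eq_zero_of_trace_mul_self_eq_zero {m : Type*} [Fintype m] {Q : Matrix m m ℝ}
    (hQ : Qᵀ = -Q) (h : (Q * Q).trace = 0) : Q = 0 := by
  rw [← trace_mul_conjTranspose_self_eq_zero_iff, conjTranspose_eq_transpose_of_trivial, hQ,
    mul_neg, trace_neg, h, neg_zero]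

/-- if `X ∈ so(n+1,n+1)` is trace-orthogonal to `i'(sl(n+1,ℝ))` and to `p̃`,
then `X = 0` (i.e. `g^⊥ ∩ p̃₊ = {0}` for the trace form). -/
theorem stmt6 (n : ℕ) (hn : 2 ≤ n) (X : Matrix (Idx n) (Idx n) ℝ) (hX : X ∈ soSplit n)
    (hg : ∀ A : Matrix (Fin (n + 1)) (Fin (n + 1)) ℝ, A.trace = 0 → (X * iEmb A).trace = 0)
    (hp : ∀ Y ∈ ptil n, (X * Y).trace = 0) :
    X = 0 := by
  obtain ⟨P, Q, R, D, rfl⟩ : ∃ P Q R D, X = fromBlocks P Q R D :=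
    ⟨_, _, _, _, (fromBlocks_toBlocks X).symm⟩
  obtain ⟨rfl, hQ, hR⟩ := fromBlocks_mem_soSplit_iff.1 hX
  have trace_eq (A S T : Matrix (Fin (n + 1)) (Fin (n + 1)) ℝ) :
      (fromBlocks P Q R (-Pᵀ) * fromBlocks A S T (-Aᵀ)).trace =
        2 * (P * A).trace + (Q * T).trace + (R * S).trace := by
    have : (Pᵀ * Aᵀ).trace = (P * A).trace := by
      rw [← transpose_mul, trace_transpose, trace_mul_comm]
    simp only [fromBlocks_multiply, trace_fromBlocks_eq_add, trace_add, neg_mul_neg, this]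
    ring
  have hP : P = 0 := by
    let k : Fin (n + 1) := ⟨1, by omega⟩
    have hk₀ : k ≠ 0 := by simp [k, Fin.ext_iff]
    have hk₁ : k ≠ Fin.last n := by simp [k, Fin.ext_iff]; omega
    have hPk : P k k = 0 := by
      have := hp _ (fromBlocks_mem_ptil (A := single k k 1) (S := 0) (T := 0) (by simp) (by simp)
        (by ext i; simp [hk₀]) (by ext i; simp [hk₁]))
      rw [trace_eq] at this
      simpa [trace_mul_single] using this
    have hPA (A : Matrix (Fin (n + 1)) (Fin (n + 1)) ℝ) (hA : A.trace = 0) :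
        (P * A).trace = 0 := by
      have := hg A hA
      rw [iEmb, trace_eq] at this
      simpa using this
    rw [eq_smul_one_of_trace_mul_eq_zero hPA k, hPk, zero_smul]
  have diag_zero {S : Matrix (Fin (n + 1)) (Fin (n + 1)) ℝ} (hS : Sᵀ = -S) (i) : S i i = 0 := by
    have := congrFun₂ hS i i
    simp only [transpose_apply, Matrix.neg_apply] at this
    linarith
  have hQ₀ : Q = 0 := by
    refine eq_zero_of_trace_mul_self_eq_zero hQ ?_
    have := hp _ (fromBlocks_mem_ptil (A := vecMulVec (Pi.single (Fin.last n) 1) (Q.col 0))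
      (S := 0) (T := Q) (by simp) hQ
      (by ext i; simp [vecMulVec_apply, diag_zero hQ]) (by ext i; simp [vecMulVec_apply]))
    rw [trace_eq] at this
    simpa [hP] using this
  have hR₀ : R = 0 := by
    refine eq_zero_of_trace_mul_self_eq_zero hR ?_
    have := hp _ (fromBlocks_mem_ptil
      (A := vecMulVec (-R.col (Fin.last n)) (Pi.single 0 1))
      (S := R) (T := 0) hR (by simp)
      (by ext i; simp [vecMulVec_apply]) (by ext i; simp [vecMulVec_apply, diag_zero hR]))
    rw [trace_eq] at this
    simpa [hP] using this
  simp [hP, hQ₀, hR₀]
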